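/- Let F be a field and let Ω be the mountain D_∞ quiver. There does not exist an infinite sequence W_1, W_2, W_3, … of indecomposable FLEI representations of Ω over F together with morphisms W_1 → W_2 → W_3 → ⋯ each of which is nonzero and not an isomorphism. -/

import Mathlib

/-- A quiver: a set of vertices, a set of arrows, with source and target maps. -/
structure Quiv : Type 1 where
  V : Type
  A : Type
  s : A → V
  t : A → V

/-- A representation of a quiver over a field `F`. -/
structure QRep (F : Type) [Field F] (Q : Quiv) : Type 1 where
  M : Q.V → Type
  [acg : ∀ i, AddCommGroup (M i)]
  [mod : ∀ i, Module F (M i)]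
  map : ∀ a : Q.A, M (Q.s a) →ₗ[F] M (Q.t a)

attribute [instance] QRep.acg QRep.mod

namespace QRep

variable {F : Type} [Field F] {Q : Quiv}

/-- A representation is nonzero if some vertex space has a nonzero vector. -/
def Nonzero (V : QRep F Q) : Prop := ∃ i, ∃ x : V.M i, x ≠ 0

/-- A morphism of representations. -/
structure Hom (V W : QRep F Q) : Type where
  app : ∀ i, V.M i →ₗ[F] W.M i
  comm : ∀ a : Q.A, (W.map a).comp (app (Q.s a)) = (app (Q.t a)).comp (V.map a)

/-- A morphism is an isomorphism iff it is bijective at each vertex. -/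
def Hom.IsIso {V W : QRep F Q} (f : Hom V W) : Prop := ∀ i, Function.Bijective (f.app i)

/-- Two representations are isomorphic. -/
def Iso (V W : QRep F Q) : Prop := ∃ f : Hom V W, f.IsIso

/-- The (external) direct sum of two representations. -/
def dsum (V W : QRep F Q) : QRep F Q where
  M i := V.M i × W.M i
  map a := (V.map a).prodMap (W.map a)

/-- A representation is indecomposable if it is nonzero and not isomorphic to a direct
sum of two nonzero representations. -/
def Indec (V : QRep F Q) : Prop :=
  V.Nonzero ∧ ∀ A B : QRep F Q, A.Nonzero → B.Nonzero → ¬ Iso V (dsum A B)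

/-- FLEI: locally finite-dimensional, and all but finitely many arrow maps are
isomorphisms. -/
def IsFLEI (V : QRep F Q) : Prop :=
  (∀ i, FiniteDimensional F (V.M i)) ∧ {a : Q.A | ¬ Function.Bijective (V.map a)}.Finite

end QRep

/-- A subrepresentation: a subspace at each vertex, stable under the arrow maps. -/
structure Subrep {F : Type} [Field F] {Q : Quiv} (V : QRep F Q) : Type where
  S : ∀ i, Submodule F (V.M i)
  stable : ∀ a : Q.A, ∀ x ∈ S (Q.s a), V.map a x ∈ S (Q.t a)

namespace Subrep

variable {F : Type} [Field F] {Q : Quiv} {V : QRep F Q}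

/-- A subrepresentation, viewed as a representation in its own right. -/
def toRep (W : Subrep V) : QRep F Q where
  M i := ↥(W.S i)
  map a := (V.map a).restrict (W.stable a)

/-- The quotient of a representation by a subrepresentation. -/
def quot (W : Subrep V) : QRep F Q where
  M i := V.M i ⧸ W.S i
  map a := Submodule.mapQ _ _ (V.map a) (fun x hx => W.stable a x hx)

end Subrep
/-- Vertices of the `D∞` quiver: two leaves `x`, `y` and a long arm indexed by `ℕ`,
with `long 0` the trivalent vertex. -/
inductive DV : Type
  | x : DV
  | y : DV
  | long : ℕ → DV

/-- Edges of the `D∞` quiver: `ex` joins `x` and `long 0`, `ey` joins `y` and `long 0`,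
and `el n` joins `long n` and `long (n+1)`. -/
inductive DE : Type
  | ex : DE
  | ey : DE
  | el : ℕ → DE

/-- One canonical endpoint of each edge of `D∞`. -/
def DE.endA : DE → DV
  | .ex => .x
  | .ey => .y
  | .el n => .long n

/-- The other canonical endpoint of each edge of `D∞`. -/
def DE.endB : DE → DV
  | .ex => .long 0
  | .ey => .long 0
  | .el n => .long (n + 1)

/-- The `D∞` quiver with the orientation of each edge chosen by `o` (if `o e = true` the
arrow goes from `endA e` to `endB e`, otherwise the other way). -/
def Dinf (o : DE → Bool) : Quiv where
  V := DV
  A := DE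
  s e := if o e then e.endA else e.endB
  t e := if o e then e.endB else e.endA

/-- The mountain `D∞` quiver: every arrow points away from the trivalent vertex
`long 0`. -/
def mountainD : Quiv where
  V := DV
  A := DE
  s e := match e with
    | .ex => .long 0
    | .ey => .long 0
    | .el n => .long n
  t e := match e with
    | .ex => .x
    | .ey => .y
    | .el n => .long (n + 1)
namespace QRep

variable {F : Type} [Field F] {Q : Quiv}

/-- A morphism is nonzero if it is nonzero at some vertex. -/
def Hom.Nonzero {V W : QRep F Q} (f : Hom V W) : Prop := ∃ i, f.app i ≠ 0

/-- A morphism is injective if it is injective at every vertex. -/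
def Hom.Injective {V W : QRep F Q} (f : Hom V W) : Prop :=
  ∀ i, Function.Injective (f.app i)

/-- A morphism is surjective if it is surjective at every vertex. -/
def Hom.Surjective {V W : QRep F Q} (f : Hom V W) : Prop :=
  ∀ i, Function.Surjective (f.app i)

end QRep

namespace QRep

variable {F : Type} [Field F]

section General

variable {Q : Quiv} {V : QRep F Q}

/-- An idempotent endomorphism of an indecomposable representation that is nonzero is the
identity. -/
theorem Indec.eq_of_idempotent (hV : V.Indec) (e : Hom V V)
    (he : ∀ i u, e.app i (e.app i u) = e.app i u) {i₀ : Q.V} {v : V.M i₀} (hv : e.app i₀ v ≠ 0) :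
    ∀ i u, e.app i u = u := by
  by_contra! h
  obtain ⟨i₁, w, hw⟩ := h
  have hcomm (a : Q.A) (u : V.M (Q.s a)) :
      V.map a (e.app (Q.s a) u) = e.app (Q.t a) (V.map a u) := LinearMap.congr_fun (e.comm a) u
  let A : Subrep V :=
    { S := fun i => LinearMap.range (e.app i)
      stable := by
        rintro a _ ⟨u, rfl⟩
        exact ⟨V.map a u, (hcomm a u).symm⟩ }
  let B : Subrep V :=
    { S := fun i => LinearMap.ker (e.app i)
      stable := by
        intro a u hu
        rw [LinearMap.mem_ker] at hu ⊢
        rw [← hcomm, hu, map_zero] }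
  have hB (i : Q.V) (u : V.M i) : u - e.app i u ∈ B.S i := by
    change e.app i _ = 0
    rw [map_sub, he, sub_self]
  let f : Hom V (dsum A.toRep B.toRep) :=
    { app := fun i => LinearMap.prod
        ((e.app i).codRestrict (A.S i) fun u => LinearMap.mem_range_self _ u)
        ((LinearMap.id - e.app i).codRestrict (B.S i) (hB i))
      comm := by
        refine fun a => LinearMap.ext fun u => Prod.ext (Subtype.ext (hcomm a u)) (Subtype.ext ?_)
        change V.map a (u - e.app _ u) = V.map a u - e.app _ (V.map a u)
        rw [map_sub, hcomm] }
  refine hV.2 A.toRep B.toRep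
    ⟨i₀, ⟨e.app i₀ v, v, rfl⟩, fun h => hv (congrArg Subtype.val h)⟩
    ⟨i₁, ⟨w - e.app i₁ w, hB i₁ w⟩, fun h => hw (sub_eq_zero.1 (congrArg Subtype.val h)).symm⟩
    ⟨f, fun i => ⟨(injective_iff_map_eq_zero _).2 fun u hu => ?_, ?_⟩⟩
  · have h1 : e.app i u = 0 := congrArg Subtype.val (congrArg Prod.fst hu)
    have h2 : u - e.app i u = 0 := congrArg Subtype.val (congrArg Prod.snd hu)
    rwa [h1, sub_zero] at h2
  · rintro ⟨⟨_, u, rfl⟩, w, hw⟩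
    have hw : e.app i w = 0 := hw
    refine ⟨e.app i u + w, Prod.ext (Subtype.ext ?_) (Subtype.ext ?_)⟩
    · change e.app i (e.app i u + w) = e.app i u
      rw [map_add, he, hw, add_zero]
    · change e.app i u + w - e.app i (e.app i u + w) = w
      rw [map_add, he, hw, add_zero, add_sub_cancel_left]

/-- The representation is one-dimensional at `i` and zero elsewhere. -/
def IsSimpleAt (V : QRep F Q) (i : Q.V) : Prop :=
  (∃ v : V.M i, v ≠ 0 ∧ ∀ u, ∃ c : F, u = c • v) ∧ ∀ j, j ≠ i → ∀ u : V.M j, u = 0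

theorem exists_functional {E : Type*} [AddCommGroup E] [Module F E] {J : Submodule F E} {v : E}
    (hv : v ∉ J) : ∃ ψ : E →ₗ[F] F, ψ v = 1 ∧ ∀ u ∈ J, ψ u = 0 := by
  obtain ⟨ψ, hψ, hJ⟩ := Submodule.exists_le_ker_of_notMem hv
  refine ⟨(ψ v)⁻¹ • ψ, by simp [hψ], fun u hu => ?_⟩
  have : ψ u = 0 := hJ hu
  simp [this]

/-- An indecomposable representation that is not covered by its incoming arrows at a sink is
simple. -/
theorem Indec.isSimpleAt (hV : V.Indec) (i : Q.V) (hsink : ∀ a, Q.s a ≠ i) (J : Submodule F (V.M i))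
    (hJ : ∀ a (h : Q.t a = i) u, h ▸ V.map a u ∈ J) {v : V.M i} (hv : v ∉ J) :
    V.IsSimpleAt i := by
  classical
  obtain ⟨ψ, hψv, hψ⟩ := exists_functional hv
  let g : V.M i →ₗ[F] V.M i := ψ.smulRight v
  have hg : ∀ u, g u = ψ u • v := fun u => rfl
  let e : Hom V V :=
    { app := Pi.single (M := fun j => V.M j →ₗ[F] V.M j) i g
      comm := by
        intro a
        rw [Pi.single_eq_of_ne (hsink a), LinearMap.comp_zero]
        by_cases h : Q.t a = i
        · subst h
          ext u
          simp [hg, hψ _ (hJ a rfl u)]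
        · rw [Pi.single_eq_of_ne h, LinearMap.zero_comp] }
  have hei : e.app i = g := Pi.single_eq_same (M := fun j => V.M j →ₗ[F] V.M j) i g
  have hej : ∀ j, j ≠ i → e.app j = 0 := fun j hj =>
    Pi.single_eq_of_ne (M := fun j => V.M j →ₗ[F] V.M j) hj g
  have hid := hV.eq_of_idempotent e (fun j u => by
    by_cases h : j = i
    · subst h
      simp [hei, hg, hψv]
    · simp [hej j h]) (i₀ := i) (v := v) (by
      rw [hei, hg, hψv, one_smul]
      rintro rfl
      exact hv J.zero_mem)
  refine ⟨⟨v, fun h => hv (h ▸ J.zero_mem), fun u => ⟨ψ u, ?_⟩⟩, fun j hj u => ?_⟩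
  · rw [← hg, ← hei, hid]
  · rw [← hid j u, hej j hj, LinearMap.zero_apply]

end General

end QRep

section Systems

variable {F : Type} [Field F] {U : Type} [AddCommGroup U] [Module F U]

/-- The space is a line. -/
def IsLine (F U : Type) [Field F] [AddCommGroup U] [Module F U] : Prop :=
  ∃ v : U, v ≠ 0 ∧ ∀ u, ∃ c : F, u = c • v

/-- Two complementary lines `X = ⟨x⟩`, `Y = ⟨y⟩` in a plane, and a chain of subspaces with values
in `⊥`, `⟨x + y⟩`, `⊤`, the middle value being attained. -/
def IsPlane (X Y : Submodule F U) (K : ℕ → Submodule F U) : Prop :=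
  ∃ x ∈ X, ∃ y ∈ Y, x ≠ 0 ∧ y ≠ 0 ∧ X ⊓ Y = ⊥ ∧ (∀ u, ∃ a b : F, u = a • x + b • y) ∧
    (∀ k, K k = ⊥ ∨ K k = ⊤ ∨ K k = F ∙ (x + y)) ∧ ∃ k, K k = F ∙ (x + y)

/-- No proper nonzero idempotent preserves all subspaces of the system. -/
def IsIndecSystem (X Y : Submodule F U) (K : ℕ → Submodule F U) : Prop :=
  ∀ g : U →ₗ[F] U, (∀ u, g (g u) = g u) → (∀ u ∈ X, g u ∈ X) → (∀ u ∈ Y, g u ∈ Y) →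
    (∀ k, ∀ u ∈ K k, g u ∈ K k) → g ≠ 0 → ∀ u, g u = u

variable {X Y : Submodule F U} {K : ℕ → Submodule F U}

theorem IsIndecSystem.isLine (h : IsIndecSystem X Y K) {v : U} {J : Submodule F U} (hv : v ∉ J)
    (hX : v ∈ X ∨ X ≤ J) (hY : v ∈ Y ∨ Y ≤ J) (hK : ∀ k, v ∈ K k ∨ K k ≤ J) : IsLine F U := by
  obtain ⟨ψ, hψv, hψ⟩ := QRep.exists_functional hv
  have key : ∀ S : Submodule F U, v ∈ S ∨ S ≤ J → ∀ u ∈ S, ψ.smulRight v u ∈ S := by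
    rintro S (hS | hS) u hu
    · exact S.smul_mem _ hS
    · simp [hψ u (hS hu)]
  have hv0 : v ≠ 0 := fun h => hv (h ▸ J.zero_mem)
  have := h (ψ.smulRight v) (by simp [hψv]) (key X hX) (key Y hY) (fun k => key _ (hK k))
    (fun h0 => hv0 (by simpa [hψv] using LinearMap.congr_fun h0 v))
  exact ⟨v, hv0, fun u => ⟨ψ u, (this u).symm⟩⟩

theorem exists_notMem_of_monotone (hK : Monotone K) (hK0 : K 0 = ⊥) {v : U} (hv : v ≠ 0) :
    ∃ J : Submodule F U, v ∉ J ∧ ∀ k, v ∈ K k ∨ K k ≤ J := by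
  by_cases h : ∃ k, v ∈ K k
  · classical
    have h0 : Nat.find h ≠ 0 := by
      intro h0
      have := Nat.find_spec h
      rw [h0, hK0] at this
      exact hv this
    obtain ⟨m, hm⟩ := Nat.exists_eq_succ_of_ne_zero h0
    refine ⟨K m, Nat.find_min h (hm ▸ Nat.lt_succ_self m), fun k => ?_⟩
    rcases le_or_gt (Nat.find h) k with hk | hk
    · exact .inl (hK hk (Nat.find_spec h))
    · exact .inr (hK (by omega))
  · push Not at h
    refine ⟨⨆ k, K k, ?_, fun k => .inr (le_iSup K k)⟩
    rw [Submodule.mem_iSup_of_directed K hK.directed_le]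
    exact fun ⟨k, hk⟩ => h k hk

/-- Classification of indecomposable systems of two subspaces and a chain. -/
theorem IsIndecSystem.isLine_or_isPlane (h : IsIndecSystem X Y K) (hK : Monotone K)
    (hK0 : K 0 = ⊥) (hU : ∃ u : U, u ≠ 0) : IsLine F U ∨ IsPlane X Y K := by
  classical
  by_contra! hcon
  obtain ⟨hline, hplane⟩ := hcon
  have hXY : X ⊓ Y = ⊥ := by
    by_contra hne
    obtain ⟨v, ⟨hvX, hvY⟩, hv⟩ := Submodule.exists_mem_ne_zero_of_ne_bot hne
    obtain ⟨J, hvJ, hJ⟩ := exists_notMem_of_monotone hK hK0 hv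
    exact hline (h.isLine hvJ (.inl hvX) (.inl hvY) hJ)
  have hXY' : X ⊔ Y = ⊤ := by
    by_contra hne
    by_cases hk : ∃ k, ¬ K k ≤ X ⊔ Y
    · obtain ⟨v, hv, hvJ⟩ := SetLike.not_le_iff_exists.1 (Nat.find_spec hk)
      refine hline (h.isLine hvJ (.inr le_sup_left) (.inr le_sup_right) fun k => ?_)
      rcases le_or_gt (Nat.find hk) k with hk' | hk'
      · exact .inl (hK hk' hv)
      · exact .inr (not_not.1 (Nat.find_min hk hk'))
    · push Not at hk
      obtain ⟨v, -, hvJ⟩ := SetLike.not_le_iff_exists.1 (fun hle => hne (top_le_iff.1 hle))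
      exact hline (h.isLine hvJ (.inr le_sup_left) (.inr le_sup_right) fun k => .inr (hk k))
  have hdisj : ∀ {v}, v ∈ X → v ∈ Y → v = 0 := fun hx hy =>
    (Submodule.mem_bot F).1 (hXY ▸ Submodule.mem_inf.2 ⟨hx, hy⟩)
  have hX : ∀ v ∈ X, v ≠ 0 → ∃ k, v ∉ K k ∧ K k ≠ ⊥ := by
    intro v hv hv0
    by_contra! hc
    exact hline (h.isLine (J := Y) (fun hy => hv0 (hdisj hv hy)) (.inl hv) (.inr le_rfl)
      fun k => or_iff_not_imp_left.2 fun hk => (hc k hk).le.trans bot_le)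
  have hY : ∀ v ∈ Y, v ≠ 0 → ∃ k, v ∉ K k ∧ K k ≠ ⊥ := by
    intro v hv hv0
    by_contra! hc
    exact hline (h.isLine (J := X) (fun hx => hv0 (hdisj hx hv)) (.inr le_rfl) (.inl hv)
      fun k => or_iff_not_imp_left.2 fun hk => (hc k hk).le.trans bot_le)
  have hdec : ∀ u : U, ∃ x ∈ X, ∃ y ∈ Y, x + y = u := fun u =>
    Submodule.mem_sup.1 (hXY' ▸ Submodule.mem_top)
  have hex : ∃ k, K k ≠ ⊥ := by
    obtain ⟨u, hu⟩ := hU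
    obtain ⟨x, hx, y, hy, rfl⟩ := hdec u
    by_cases hx0 : x = 0
    · obtain ⟨k, -, hk⟩ := hY y hy (by rintro rfl; simp [hx0] at hu)
      exact ⟨k, hk⟩
    · obtain ⟨k, -, hk⟩ := hX x hx hx0
      exact ⟨k, hk⟩
  set k₀ := Nat.find hex with hk₀
  have hlow : ∀ j < k₀, K j = ⊥ := fun j hj => not_not.1 (Nat.find_min hex hj)
  have hge : ∀ j, K j ≠ ⊥ → k₀ ≤ j := fun j hj => Nat.find_min' hex hj
  obtain ⟨l, hl, hl0⟩ := Submodule.exists_mem_ne_zero_of_ne_bot (Nat.find_spec hex)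
  obtain ⟨x, hx, y, hy, rfl⟩ := hdec l
  have hx0 : x ≠ 0 := by
    rintro rfl
    rw [zero_add] at hl hl0
    obtain ⟨k, hk, hk'⟩ := hY y hy hl0
    exact hk (hK (hge k hk') hl)
  have hy0 : y ≠ 0 := by
    rintro rfl
    rw [add_zero] at hl hl0
    obtain ⟨k, hk, hk'⟩ := hX x hx hl0
    exact hk (hK (hge k hk') hl)
  have hxl : x ∉ K k₀ := by
    obtain ⟨k, hk, hk'⟩ := hX x hx hx0
    exact fun hc => hk (hK (hge k hk') hc)
  obtain ⟨J, hxJ, hJ⟩ := exists_notMem_of_monotone hK hK0 hx0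
  obtain ⟨θ, hθx, hθ⟩ := QRep.exists_functional hxJ
  have hθl : θ (x + y) = 0 := hθ _ ((hJ k₀).resolve_left hxl hl)
  have hθy : θ y = -1 := by
    rw [map_add, hθx] at hθl
    linear_combination hθl
  have hc : IsCompl X Y := ⟨disjoint_iff.2 hXY, codisjoint_iff.2 hXY'⟩
  let p : U →ₗ[F] U := X.projection Y hc
  have hpX : ∀ u ∈ X, p u = u := fun u hu => Submodule.projection_apply_of_mem_left hc hu
  have hpY : ∀ u ∈ Y, p u = 0 := fun u hu => Submodule.projection_apply_of_mem_right hc hu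
  let g : U →ₗ[F] U := (θ ∘ₗ p).smulRight x - (θ ∘ₗ (LinearMap.id - p)).smulRight y
  have hg : ∀ u, g u = θ (p u) • x - θ (u - p u) • y := fun u => rfl
  have hgx : g x = x := by simp [hg, hpX x hx, hθx]
  have hgy : g y = y := by simp [hg, hpY y hy, hθy]
  have hgid : ∀ u, g u = u := by
    refine h g (fun u => ?_) (fun u hu => ?_) (fun u hu => ?_) (fun k u hu => ?_)
      (fun h0 => hx0 (by rw [← hgx, h0, LinearMap.zero_apply]))
    · conv_lhs => rw [hg u, map_sub, map_smul, map_smul, hgx, hgy]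
      rw [hg u]
    · rw [hg, hpX u hu, sub_self, map_zero, zero_smul, sub_zero]
      exact X.smul_mem _ hx
    · rw [hg, hpY u hu, map_zero, zero_smul, zero_sub]
      exact Y.neg_mem (Y.smul_mem _ hy)
    · rcases lt_or_ge k k₀ with hk | hk
      · rw [hlow k hk, Submodule.mem_bot] at hu
        rw [hu, map_zero]
        exact Submodule.zero_mem _
      · have hlk := hK hk hl
        rcases hJ k with hxk | hkJ
        · have hyk : y ∈ K k := (Submodule.add_mem_iff_right _ hxk).1 hlk
          exact Submodule.sub_mem _ (Submodule.smul_mem _ _ hxk) (Submodule.smul_mem _ _ hyk)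
        · have h0 := hθ u (hkJ hu)
          have : g u = θ (p u) • (x + y) := by
            rw [hg, map_sub, h0, zero_sub, neg_smul, sub_neg_eq_add, smul_add]
          rw [this]
          exact Submodule.smul_mem _ _ hlk
  have hspan : ∀ k, x ∉ K k → K k ≠ ⊥ → K k = F ∙ (x + y) := by
    intro k hxk hk
    refine le_antisymm (fun u hu => ?_) ?_
    · have h0 := hθ u ((hJ k).resolve_left hxk hu)
      refine Submodule.mem_span_singleton.2 ⟨θ (p u), ?_⟩
      conv_rhs => rw [← hgid u, hg, map_sub, h0, zero_sub, neg_smul, sub_neg_eq_add, ← smul_add]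
    · rw [Submodule.span_singleton_le_iff_mem]
      exact hK (hge k hk) hl
  refine hplane ⟨x, hx, y, hy, hx0, hy0, hXY, fun u => ⟨θ (p u), -θ (u - p u), ?_⟩, fun k => ?_,
    k₀, hspan k₀ hxl (Nat.find_spec hex)⟩
  · rw [neg_smul, ← sub_eq_add_neg, ← hg, hgid]
  · by_cases hk : K k = ⊥
    · exact .inl hk
    · by_cases hxk : x ∈ K k
      · have hyk : y ∈ K k := (Submodule.add_mem_iff_right _ hxk).1 (hK (hge k hk) hl)
        refine .inr (.inl (eq_top_iff.2 fun u _ => ?_))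
        rw [← hgid u, hg]
        exact Submodule.sub_mem _ (Submodule.smul_mem _ _ hxk) (Submodule.smul_mem _ _ hyk)
      · exact .inr (.inr (hspan k hxk hk))

end Systems

section SystemMaps

variable {F : Type} [Field F] {U U' : Type} [AddCommGroup U] [Module F U] [AddCommGroup U']
  [Module F U'] {X Y : Submodule F U} {K : ℕ → Submodule F U} {X' Y' : Submodule F U'}
  {K' : ℕ → Submodule F U'} {φ : U →ₗ[F] U'}

theorem IsLine.eq_bot_or_eq_top (h : IsLine F U) (S : Submodule F U) : S = ⊥ ∨ S = ⊤ := by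
  obtain ⟨v, hv, h⟩ := h
  refine or_iff_not_imp_left.2 fun hS => ?_
  obtain ⟨w, hw, hw0⟩ := Submodule.exists_mem_ne_zero_of_ne_bot hS
  obtain ⟨c, rfl⟩ := h w
  have hc : c ≠ 0 := by
    rintro rfl
    simp at hw0
  have hvS : v ∈ S := (S.smul_mem_iff hc).1 hw
  refine eq_top_iff.2 fun u _ => ?_
  obtain ⟨d, rfl⟩ := h u
  exact S.smul_mem d hvS

theorem IsLine.eq_top_of_mem (h : IsLine F U) {S : Submodule F U} {w : U} (hw : w ∈ S)
    (hw0 : w ≠ 0) : S = ⊤ :=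
  (h.eq_bot_or_eq_top S).resolve_left fun hS => hw0 ((Submodule.mem_bot F).1 (hS ▸ hw))

theorem IsLine.injective (h : IsLine F U) (hφ : φ ≠ 0) : Function.Injective φ :=
  LinearMap.ker_eq_bot.1 <| (h.eq_bot_or_eq_top _).resolve_right fun h =>
    hφ (LinearMap.ker_eq_top.1 h)

theorem IsLine.surjective (h : IsLine F U') (hφ : φ ≠ 0) : Function.Surjective φ :=
  LinearMap.range_eq_top.1 <| (h.eq_bot_or_eq_top _).resolve_left fun h =>
    hφ (LinearMap.range_eq_bot.1 h)

theorem exists_apply_ne_zero (hφ : φ ≠ 0) : ∃ u, φ u ≠ 0 := by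
  by_contra! h
  exact hφ (LinearMap.ext h)

/-- The underlying configuration of a system is `X ⊕ Y` with `X` and `Y` at most
one-dimensional, and the chain meets `X` and `Y` only in its full term. -/
structure IsSplit (X Y : Submodule F U) (K : ℕ → Submodule F U) : Prop where
  disj : ∀ u ∈ X, u ∈ Y → u = 0
  exists_add : ∀ u, ∃ x ∈ X, ∃ y ∈ Y, x + y = u
  left_line : ∀ u ∈ X, u ≠ 0 → ∀ w ∈ X, ∃ c : F, w = c • u
  right_line : ∀ u ∈ Y, u ≠ 0 → ∀ w ∈ Y, ∃ c : F, w = c • u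
  eq_top : ∀ k, ∀ u ∈ K k, (u ∈ X ∨ u ∈ Y) → u ≠ 0 → K k = ⊤

theorem IsLine.isSplit (h : IsLine F U) (h₁ : X ⊓ Y = ⊥) (h₂ : X ⊔ Y ≠ ⊥) : IsSplit X Y K where
  disj u hx hy := (Submodule.mem_bot F).1 (h₁ ▸ Submodule.mem_inf.2 ⟨hx, hy⟩)
  exists_add u := Submodule.mem_sup.1 <|
    (h.eq_bot_or_eq_top (X ⊔ Y)).resolve_left h₂ ▸ Submodule.mem_top
  left_line u _ hu w _ := by
    have := h.eq_top_of_mem (Submodule.mem_span_singleton_self (R := F) u) hu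
    obtain ⟨c, hc⟩ := Submodule.mem_span_singleton.1 (this ▸ Submodule.mem_top : w ∈ F ∙ u)
    exact ⟨c, hc.symm⟩
  right_line u _ hu w _ := by
    have := h.eq_top_of_mem (Submodule.mem_span_singleton_self (R := F) u) hu
    obtain ⟨c, hc⟩ := Submodule.mem_span_singleton.1 (this ▸ Submodule.mem_top : w ∈ F ∙ u)
    exact ⟨c, hc.symm⟩
  eq_top k u hu _ h0 := h.eq_top_of_mem hu h0

theorem IsPlane.isSplit (h : IsPlane X Y K) : IsSplit X Y K := by
  obtain ⟨x, hx, y, hy, hx0, hy0, hXY, hspan, hK, -⟩ := h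
  have disj : ∀ u ∈ X, u ∈ Y → u = 0 := fun u hx hy =>
    (Submodule.mem_bot F).1 (hXY ▸ Submodule.mem_inf.2 ⟨hx, hy⟩)
  have hXx : ∀ u ∈ X, ∃ c : F, u = c • x := by
    intro u hu
    obtain ⟨a, b, rfl⟩ := hspan u
    have : b • y = 0 := disj _ ((Submodule.add_mem_iff_right _ (X.smul_mem a hx)).1 hu)
      (Y.smul_mem b hy)
    exact ⟨a, by rw [this, add_zero]⟩
  have hYy : ∀ u ∈ Y, ∃ c : F, u = c • y := by
    intro u hu
    obtain ⟨a, b, rfl⟩ := hspan u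
    have : a • x = 0 := disj _ (X.smul_mem a hx)
      ((Submodule.add_mem_iff_left _ (Y.smul_mem b hy)).1 hu)
    exact ⟨b, by rw [this, zero_add]⟩
  refine ⟨disj, fun u => ?_, fun u hu hu0 w hw => ?_, fun u hu hu0 w hw => ?_, ?_⟩
  · obtain ⟨a, b, rfl⟩ := hspan u
    exact ⟨_, X.smul_mem a hx, _, Y.smul_mem b hy, rfl⟩
  · obtain ⟨c, rfl⟩ := hXx u hu
    obtain ⟨d, rfl⟩ := hXx w hw
    have hc : c ≠ 0 := by rintro rfl; simp at hu0
    exact ⟨d / c, by rw [smul_smul, div_mul_cancel₀ _ hc]⟩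
  · obtain ⟨c, rfl⟩ := hYy u hu
    obtain ⟨d, rfl⟩ := hYy w hw
    have hc : c ≠ 0 := by rintro rfl; simp at hu0
    exact ⟨d / c, by rw [smul_smul, div_mul_cancel₀ _ hc]⟩
  · intro k u hu huXY hu0
    rcases hK k with hk | hk | hk
    · rw [hk] at hu
      exact absurd ((Submodule.mem_bot F).1 hu) hu0
    · exact hk
    · rw [hk] at hu
      obtain ⟨c, rfl⟩ := Submodule.mem_span_singleton.1 hu
      have hc : c ≠ 0 := by rintro rfl; simp at hu0
      rcases huXY with h | h
      · have := (Submodule.add_mem_iff_right _ hx).1 ((X.smul_mem_iff hc).1 h)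
        exact absurd (disj y this hy) hy0
      · have := (Submodule.add_mem_iff_left _ hy).1 ((Y.smul_mem_iff hc).1 h)
        exact absurd (disj x hx this) hx0

theorem IsPlane.exists_ne (h : IsPlane X Y K) : ∃ k, K k ≠ ⊥ ∧ K k ≠ ⊤ := by
  obtain ⟨x, hx, y, hy, hx0, hy0, hXY, hspan, hK, k, hk⟩ := h
  have disj : ∀ u ∈ X, u ∈ Y → u = 0 := fun u hx hy =>
    (Submodule.mem_bot F).1 (hXY ▸ Submodule.mem_inf.2 ⟨hx, hy⟩)
  refine ⟨k, fun h0 => ?_, fun h1 => ?_⟩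
  · have : x + y = 0 := by
      rw [← Submodule.span_singleton_eq_bot (R := F), ← hk, h0]
    have hx' : x ∈ Y := by
      rw [eq_neg_of_add_eq_zero_left this]
      exact Y.neg_mem hy
    exact hx0 (disj x hx hx')
  · obtain ⟨c, hc⟩ := Submodule.mem_span_singleton.1
      (hk ▸ h1 ▸ Submodule.mem_top : x ∈ F ∙ (x + y))
    have hc0 : c ≠ 0 := by
      rintro rfl
      exact hx0 (by rw [← hc, zero_smul])
    have : c • y ∈ X := by
      rw [smul_add] at hc
      rw [← Submodule.add_mem_iff_right _ (X.smul_mem c hx), hc]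
      exact hx
    exact hy0 (disj y ((X.smul_mem_iff hc0).1 this) hy)

theorem IsSplit.exists_apply_ne_zero (h : IsSplit X Y K) (hφ : φ ≠ 0) :
    ∃ u, (u ∈ X ∨ u ∈ Y) ∧ φ u ≠ 0 := by
  by_contra! hc
  refine hφ (LinearMap.ext fun u => ?_)
  obtain ⟨x, hx, y, hy, rfl⟩ := h.exists_add u
  rw [map_add, hc x (.inl hx), hc y (.inr hy), add_zero, LinearMap.zero_apply]

theorem IsSplit.eq_top_of_eq_top (h : IsSplit X Y K) (h' : IsSplit X' Y' K') (hφ : φ ≠ 0)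
    (hX : ∀ u ∈ X, φ u ∈ X') (hY : ∀ u ∈ Y, φ u ∈ Y') (hK : ∀ k, ∀ u ∈ K k, φ u ∈ K' k) {k : ℕ}
    (hk : K k = ⊤) : K' k = ⊤ := by
  obtain ⟨u, hu, hu0⟩ := h.exists_apply_ne_zero hφ
  exact h'.eq_top k (φ u) (hK k u (hk ▸ Submodule.mem_top)) (hu.imp (hX u) (hY u)) hu0

theorem IsSplit.ne_bot_of_ne_bot (h : IsSplit X Y K) (h' : IsSplit X' Y' K') (hφ : φ ≠ 0)
    (hX : ∀ u ∈ X, φ u ∈ X') (hY : ∀ u ∈ Y, φ u ∈ Y') (hK : ∀ k, ∀ u ∈ K k, φ u ∈ K' k) {k : ℕ}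
    (hk : K k ≠ ⊥) : K' k ≠ ⊥ := by
  intro hk'
  obtain ⟨w, hw, hw0⟩ := Submodule.exists_mem_ne_zero_of_ne_bot hk
  have hzero : ∀ u ∈ K k, φ u = 0 := fun u hu => (Submodule.mem_bot F).1 (hk' ▸ hK k u hu)
  obtain ⟨x, hx, y, hy, rfl⟩ := h.exists_add w
  have hsum : φ x + φ y = 0 := by rw [← map_add, hzero _ hw]
  have hφx : φ x = 0 := by
    refine h'.disj _ (hX x hx) ?_
    rw [eq_neg_of_add_eq_zero_left hsum]
    exact Y'.neg_mem (hY y hy)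
  have hφy : φ y = 0 := by rwa [hφx, zero_add] at hsum
  have htop : K k = ⊤ := by
    refine h.eq_top k _ hw ?_ hw0
    by_cases hx0 : x = 0
    · right
      simpa [hx0] using hy
    by_cases hy0 : y = 0
    · left
      simpa [hy0] using hx
    obtain ⟨u, hu, hu0⟩ := h.exists_apply_ne_zero hφ
    rcases hu with hu | hu
    · obtain ⟨c, rfl⟩ := h.left_line x hx hx0 u hu
      simp [hφx] at hu0
    · obtain ⟨c, rfl⟩ := h.right_line y hy hy0 u hu
      simp [hφy] at hu0
  exact hφ (LinearMap.ext fun u => hzero u (htop ▸ Submodule.mem_top))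

/-- The map is bijective and its inverse preserves the subspaces of the systems. -/
def IsSystemIso (φ : U →ₗ[F] U') (X Y : Submodule F U) (K : ℕ → Submodule F U)
    (X' Y' : Submodule F U') (K' : ℕ → Submodule F U') : Prop :=
  Function.Bijective φ ∧ (∀ u, φ u ∈ X' → u ∈ X) ∧ (∀ u, φ u ∈ Y' → u ∈ Y) ∧
    ∀ k, ∀ u, φ u ∈ K' k → u ∈ K k

theorem IsPlane.isSystemIso (h : IsPlane X Y K) (h' : IsPlane X' Y' K')
    (hX : ∀ u ∈ X, φ u ∈ X') (hY : ∀ u ∈ Y, φ u ∈ Y') (hK : ∀ k, ∀ u ∈ K k, φ u ∈ K' k)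
    (hφ : φ ≠ 0) (hbot : ∀ k, K k = ⊥ ↔ K' k = ⊥) (htop : ∀ k, K k = ⊤ ↔ K' k = ⊤) :
    IsSystemIso φ X Y K X' Y' K' := by
  obtain ⟨k, hkb, hkt⟩ := h.exists_ne
  obtain ⟨x, hx, y, hy, hx0, hy0, hXY, hspan, hKv, -⟩ := h
  have disj := h'.isSplit.disj
  obtain ⟨x', hx', y', hy', hx0', hy0', -, hspan', hKv', -⟩ := h'
  have unique : ∀ a b c d : F, a • x' + b • y' = c • x' + d • y' → a = c ∧ b = d := by
    intro a b c d hab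
    have h1 : (a - c) • x' = (d - b) • y' := by
      rw [sub_smul, sub_smul, sub_eq_sub_iff_add_eq_add, hab, add_comm]
    have h2 : (a - c) • x' = 0 :=
      disj _ (X'.smul_mem _ hx') (h1 ▸ Y'.smul_mem _ hy')
    have h3 := (smul_eq_zero.1 h2).resolve_right hx0'
    have h4 := (smul_eq_zero.1 (h1 ▸ h2)).resolve_right hy0'
    exact ⟨sub_eq_zero.1 h3, (sub_eq_zero.1 h4).symm⟩
  have hkl := ((hKv k).resolve_left hkb).resolve_left hkt
  have hkl' := ((hKv' k).resolve_left fun h => hkb ((hbot k).2 h)).resolve_left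
    fun h => hkt ((htop k).2 h)
  have hl : φ (x + y) ∈ F ∙ (x' + y') := hkl' ▸ hK k _ (hkl ▸ Submodule.mem_span_singleton_self _)
  obtain ⟨c, hc⟩ := Submodule.mem_span_singleton.1 hl
  have hdiff : φ x - c • x' = c • y' - φ y := by
    rw [map_add, smul_add] at hc
    rw [sub_eq_sub_iff_add_eq_add, ← hc, add_comm]
  have hzero : φ x - c • x' = 0 := disj _ (X'.sub_mem (hX x hx) (X'.smul_mem c hx'))
    (hdiff ▸ Y'.sub_mem (Y'.smul_mem c hy') (hY y hy))
  have hφx : φ x = c • x' := sub_eq_zero.1 hzero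
  have hφy : φ y = c • y' := (sub_eq_zero.1 (hdiff ▸ hzero)).symm
  have hφab : ∀ a b : F, φ (a • x + b • y) = (a * c) • x' + (b * c) • y' := fun a b => by
    rw [map_add, map_smul, map_smul, hφx, hφy, smul_smul, smul_smul]
  have hc0 : c ≠ 0 := by
    rintro rfl
    refine hφ (LinearMap.ext fun u => ?_)
    obtain ⟨a, b, rfl⟩ := hspan u
    simp [hφab]
  have hinj : ∀ u, φ u = 0 → u = 0 := by
    intro u hu
    obtain ⟨a, b, rfl⟩ := hspan u
    obtain ⟨ha, hb⟩ := unique (a * c) (b * c) 0 0 (by rw [← hφab, hu]; simp)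
    simp [(mul_eq_zero.1 ha).resolve_right hc0, (mul_eq_zero.1 hb).resolve_right hc0]
  refine ⟨⟨(injective_iff_map_eq_zero φ).2 hinj, fun u' => ?_⟩, fun u hu => ?_, fun u hu => ?_,
    fun j u hu => ?_⟩
  · obtain ⟨a, b, rfl⟩ := hspan' u'
    exact ⟨(a / c) • x + (b / c) • y, by
      rw [hφab, div_mul_cancel₀ _ hc0, div_mul_cancel₀ _ hc0]⟩
  · obtain ⟨a, b, rfl⟩ := hspan u
    rw [hφab, Submodule.add_mem_iff_right _ (X'.smul_mem _ hx')] at hu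
    have := (smul_eq_zero.1 (disj _ hu (Y'.smul_mem _ hy'))).resolve_right hy0'
    rw [(mul_eq_zero.1 this).resolve_right hc0, zero_smul, add_zero]
    exact X.smul_mem a hx
  · obtain ⟨a, b, rfl⟩ := hspan u
    rw [hφab, Submodule.add_mem_iff_left _ (Y'.smul_mem _ hy')] at hu
    have := (smul_eq_zero.1 (disj _ (X'.smul_mem _ hx') hu)).resolve_right hx0'
    rw [(mul_eq_zero.1 this).resolve_right hc0, zero_smul, zero_add]
    exact Y.smul_mem b hy
  · by_cases hjb : K j = ⊥
    · rw [(hbot j).1 hjb, Submodule.mem_bot] at hu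
      rw [hinj u hu]
      exact Submodule.zero_mem _
    by_cases hjt : K j = ⊤
    · rw [hjt]
      exact Submodule.mem_top
    rw [((hKv' j).resolve_left fun h => hjb ((hbot j).2 h)).resolve_left
      fun h => hjt ((htop j).2 h)] at hu
    rw [((hKv j).resolve_left hjb).resolve_left hjt]
    obtain ⟨a, b, rfl⟩ := hspan u
    obtain ⟨d, hd⟩ := Submodule.mem_span_singleton.1 hu
    rw [hφab, smul_add] at hd
    obtain ⟨h1, h2⟩ := unique _ _ _ _ hd
    obtain rfl : a = b := mul_right_cancel₀ hc0 (h1.symm.trans h2)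
    exact Submodule.mem_span_singleton.2 ⟨a, smul_add _ _ _⟩

open Classical in
/-- The position of the pair of subspaces, decreasing along nonzero maps of indecomposable
systems. -/
noncomputable def stage (X Y : Submodule F U) : ℕ :=
  if X ⊓ Y ≠ ⊥ then 0 else if X ⊔ Y ≠ ⊥ then 1 else 2

theorem stage_comm (X Y : Submodule F U) : stage X Y = stage Y X := by
  rw [stage, stage, inf_comm, sup_comm]

theorem stage_le_stage (h : IsLine F U ∨ IsPlane X Y K) (hφ : φ ≠ 0)
    (hX : ∀ u ∈ X, φ u ∈ X') (hY : ∀ u ∈ Y, φ u ∈ Y') : stage X' Y' ≤ stage X Y := by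
  obtain ⟨u, hu⟩ := exists_apply_ne_zero hφ
  have h1 : X ⊓ Y ≠ ⊥ → X' ⊓ Y' ≠ ⊥ := by
    intro hne h0
    have htop : X ⊓ Y = ⊤ := by
      rcases h with h | h
      · exact (h.eq_bot_or_eq_top _).resolve_left hne
      · obtain ⟨x, hx, y, hy, hx0, hy0, hXY, -⟩ := h
        exact absurd hXY hne
    have huXY : u ∈ X ⊓ Y := htop ▸ Submodule.mem_top
    exact hu ((Submodule.mem_bot F).1 (h0 ▸ Submodule.mem_inf.2 ⟨hX u huXY.1, hY u huXY.2⟩))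
  have h2 : X ⊔ Y ≠ ⊥ → X' ⊔ Y' ≠ ⊥ := by
    intro hne h0
    obtain ⟨x, hx, y, hy, rfl⟩ : ∃ x ∈ X, ∃ y ∈ Y, x + y = u := by
      rcases h with h | h
      · exact Submodule.mem_sup.1
          ((h.eq_bot_or_eq_top (X ⊔ Y)).resolve_left hne ▸ Submodule.mem_top)
      · exact h.isSplit.exists_add u
    refine hu ((Submodule.mem_bot F).1 (h0 ▸ ?_))
    rw [map_add]
    exact Submodule.add_mem_sup (hX x hx) (hY y hy)
  unfold stage
  split_ifs <;> first | omega | tauto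

theorem IsPlane.stage_eq (h : IsPlane X Y K) : stage X Y = 1 := by
  obtain ⟨x, hx, y, hy, hx0, hy0, hXY, -⟩ := h
  have : X ⊔ Y ≠ ⊥ := fun h0 =>
    hx0 ((Submodule.mem_bot F).1 (h0 ▸ Submodule.mem_sup_left hx))
  simp [stage, hXY, this]

theorem isSplit_of_stage_eq_one (h : IsLine F U ∨ IsPlane X Y K) (hs : stage X Y = 1) :
    IsSplit X Y K := by
  rcases h with h | h
  · unfold stage at hs
    split_ifs at hs with h1 h2
    · exact h.isSplit (not_not.1 h1) h2
    · omega
  · exact h.isSplit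

theorem ne_bot_and_eq_top_of_stage_eq (h : IsLine F U ∨ IsPlane X Y K)
    (h' : IsLine F U' ∨ IsPlane X' Y' K') (hφ : φ ≠ 0) (hs : stage X' Y' = stage X Y)
    (hX : ∀ u ∈ X, φ u ∈ X') (hY : ∀ u ∈ Y, φ u ∈ Y') (hK : ∀ k, ∀ u ∈ K k, φ u ∈ K' k) (k : ℕ) :
    (K k ≠ ⊥ → K' k ≠ ⊥) ∧ (K k = ⊤ → K' k = ⊤) := by
  by_cases h1 : stage X Y = 1
  · have hS := isSplit_of_stage_eq_one h h1
    have hS' := isSplit_of_stage_eq_one h' (hs.trans h1)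
    exact ⟨hS.ne_bot_of_ne_bot hS' hφ hX hY hK, hS.eq_top_of_eq_top hS' hφ hX hY hK⟩
  · have hl := h.resolve_right fun h => h1 h.stage_eq
    have hl' := h'.resolve_right fun h => h1 (hs ▸ h.stage_eq)
    refine ⟨fun hk hk' => ?_, fun hk => ?_⟩
    · obtain ⟨u, hu, hu0⟩ := Submodule.exists_mem_ne_zero_of_ne_bot hk
      have := (Submodule.mem_bot F).1 (hk' ▸ hK k u hu)
      exact hu0 ((injective_iff_map_eq_zero φ).1 (hl.injective hφ) u this)
    · obtain ⟨u, hu⟩ := exists_apply_ne_zero hφ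
      exact hl'.eq_top_of_mem (hK k u (hk ▸ Submodule.mem_top)) hu

theorem IsLine.isSystemIso (h : IsLine F U) (h' : IsLine F U') (hφ : φ ≠ 0)
    (hs : stage X' Y' = stage X Y) (hX : ∀ u ∈ X, φ u ∈ X') (hY : ∀ u ∈ Y, φ u ∈ Y')
    (hbot : ∀ k, K k = ⊥ ↔ K' k = ⊥) : IsSystemIso φ X Y K X' Y' K' := by
  have hinj := (injective_iff_map_eq_zero φ).1 (h.injective hφ)
  obtain ⟨v, hv⟩ := exists_apply_ne_zero hφ
  have key : ∀ (S : Submodule F U) (S' : Submodule F U'), (S = ⊥ → S' = ⊥) →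
      ∀ u, φ u ∈ S' → u ∈ S := by
    intro S S' hSS u hu
    rcases h.eq_bot_or_eq_top S with hS | hS
    · rw [hSS hS, Submodule.mem_bot] at hu
      rw [hinj u hu]
      exact S.zero_mem
    · rw [hS]
      exact Submodule.mem_top
  have htb : (⊤ : Submodule F U) ≠ ⊥ := fun h0 => by
    have : v = 0 := (Submodule.mem_bot F).1 (h0 ▸ Submodule.mem_top)
    simp [this] at hv
  have htb' : (⊤ : Submodule F U') ≠ ⊥ := fun h0 =>
    hv ((Submodule.mem_bot F).1 (h0 ▸ Submodule.mem_top))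
  have htop : ∀ (S : Submodule F U) (S' : Submodule F U'), (∀ u ∈ S, φ u ∈ S') → S = ⊤ →
      S' = ⊤ := fun S S' hS hS' => h'.eq_top_of_mem (hS v (hS' ▸ Submodule.mem_top)) hv
  have hXt := htop X X' hX
  have hYt := htop Y Y' hY
  have hbot' : ∀ (S T : Submodule F U) (S' T' : Submodule F U'), stage S' T' = stage S T →
      (T = ⊤ → T' = ⊤) → S = ⊥ → S' = ⊥ := by
    rintro S T S' T' hst hT rfl
    refine (h'.eq_bot_or_eq_top S').resolve_right ?_
    rintro rfl
    rcases h.eq_bot_or_eq_top T with rfl | rfl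
    · have h2 : stage (⊥ : Submodule F U) ⊥ = 2 := by simp [stage]
      have h1 : stage (⊤ : Submodule F U') T' ≤ 1 := by
        rw [stage, top_sup_eq, if_pos htb']
        split_ifs <;> omega
      omega
    · rw [hT rfl, stage, stage, if_pos (by rwa [top_inf_eq]), if_neg (by simp),
        if_pos (by rwa [bot_sup_eq])] at hst
      omega
  exact ⟨⟨h.injective hφ, h'.surjective hφ⟩, key _ _ (hbot' X Y X' Y' hs hYt),
    key _ _ (hbot' Y X Y' X' (by rwa [stage_comm, stage_comm Y]) hXt), fun k => key _ _ (hbot k).1⟩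

theorem isSystemIso_of_stage_eq (h : IsLine F U ∨ IsPlane X Y K)
    (h' : IsLine F U' ∨ IsPlane X' Y' K') (hφ : φ ≠ 0) (hs : stage X' Y' = stage X Y)
    (hX : ∀ u ∈ X, φ u ∈ X') (hY : ∀ u ∈ Y, φ u ∈ Y') (hK : ∀ k, ∀ u ∈ K k, φ u ∈ K' k)
    (hbot : ∀ k, K k = ⊥ ↔ K' k = ⊥) (htop : ∀ k, K k = ⊤ ↔ K' k = ⊤) :
    IsSystemIso φ X Y K X' Y' K' := by
  rcases h with h | h <;> rcases h' with h' | h'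
  · exact h.isSystemIso h' hφ hs hX hY hbot
  · obtain ⟨k, hkb, hkt⟩ := h'.exists_ne
    exact absurd (h.eq_bot_or_eq_top (K k)) (by simp [hbot, htop, hkb, hkt])
  · obtain ⟨k, hkb, hkt⟩ := h.exists_ne
    exact absurd (h'.eq_bot_or_eq_top (K' k)) (by simp [← hbot, ← htop, hkb, hkt])
  · exact h.isSystemIso h' hX hY hK hφ hbot htop

end SystemMaps

namespace QRep

section Mountain

variable {F : Type} [Field F] {W W' : QRep F mountainD}

/-- The end of the first short leg of `D∞`. -/
abbrev vertexX : mountainD.V := DV.x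

/-- The end of the second short leg of `D∞`. -/
abbrev vertexY : mountainD.V := DV.y

/-- The vertices of the long arm of `D∞`. -/
abbrev vertexLong (k : ℕ) : mountainD.V := DV.long k

/-- The map along the first short leg. -/
def legX (W : QRep F mountainD) : W.M (vertexLong 0) →ₗ[F] W.M vertexX := W.map DE.ex

/-- The map along the second short leg. -/
def legY (W : QRep F mountainD) : W.M (vertexLong 0) →ₗ[F] W.M vertexY := W.map DE.ey

/-- The maps along the long arm. -/
def arm (W : QRep F mountainD) (k : ℕ) : W.M (vertexLong k) →ₗ[F] W.M (vertexLong (k + 1)) :=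
  W.map (DE.el k)

/-- Build a morphism of representations of the mountain quiver. -/
def mkHom (app : ∀ i, W.M i →ₗ[F] W'.M i)
    (hX : ∀ u, W'.legX (app (vertexLong 0) u) = app vertexX (W.legX u))
    (hY : ∀ u, W'.legY (app (vertexLong 0) u) = app vertexY (W.legY u))
    (hA : ∀ k u, W'.arm k (app (vertexLong k) u) = app (vertexLong (k + 1)) (W.arm k u)) :
    Hom W W' where
  app := app
  comm
    | .ex => LinearMap.ext hX
    | .ey => LinearMap.ext hY
    | .el k => LinearMap.ext (hA k)

theorem Hom.legX_app (f : Hom W W') (u : W.M (vertexLong 0)) :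
    W'.legX (f.app (vertexLong 0) u) = f.app vertexX (W.legX u) :=
  LinearMap.congr_fun (f.comm DE.ex) u

theorem Hom.legY_app (f : Hom W W') (u : W.M (vertexLong 0)) :
    W'.legY (f.app (vertexLong 0) u) = f.app vertexY (W.legY u) :=
  LinearMap.congr_fun (f.comm DE.ey) u

theorem Hom.arm_app (f : Hom W W') (k : ℕ) (u : W.M (vertexLong k)) :
    W'.arm k (f.app (vertexLong k) u) = f.app (vertexLong (k + 1)) (W.arm k u) :=
  LinearMap.congr_fun (f.comm (DE.el k)) u

/-- The composite of the maps along the long arm from `i` to `j`. -/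
def trans (W : QRep F mountainD) {i j : ℕ} (h : i ≤ j) :
    W.M (vertexLong i) →ₗ[F] W.M (vertexLong j) :=
  Nat.leRec (motive := fun j _ => W.M (vertexLong i) →ₗ[F] W.M (vertexLong j)) LinearMap.id
    (fun k _ g => W.arm k ∘ₗ g) h

theorem trans_self (W : QRep F mountainD) {i : ℕ} (h : i ≤ i) (u : W.M (vertexLong i)) :
    W.trans h u = u := by
  rw [trans, Nat.leRec_self, LinearMap.id_apply]

theorem trans_succ (W : QRep F mountainD) {i j : ℕ} (h : i ≤ j) (h' : i ≤ j + 1)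
    (u : W.M (vertexLong i)) : W.trans h' u = W.arm j (W.trans h u) := by
  rw [trans, Nat.leRec_succ _ _ h, LinearMap.comp_apply]
  rfl

theorem trans_trans (W : QRep F mountainD) {i j k : ℕ} (h : i ≤ j) (h' : j ≤ k)
    (u : W.M (vertexLong i)) : W.trans h' (W.trans h u) = W.trans (h.trans h') u := by
  induction k, h' using Nat.le_induction with
  | base => rw [trans_self]
  | succ k hk ih => rw [trans_succ W hk, ih, ← trans_succ]

theorem trans_arm (W : QRep F mountainD) {i j : ℕ} (h : i + 1 ≤ j) (u : W.M (vertexLong i)) :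
    W.trans h (W.arm i u) = W.trans (Nat.le_of_succ_le h) u := by
  rw [← trans_trans W (Nat.le_succ i) h, trans_succ W le_rfl, trans_self]

theorem Hom.trans_app (f : Hom W W') {i j : ℕ} (h : i ≤ j) (u : W.M (vertexLong i)) :
    W'.trans h (f.app (vertexLong i) u) = f.app (vertexLong j) (W.trans h u) := by
  induction j, h using Nat.le_induction with
  | base => rw [trans_self, trans_self]
  | succ j hj ih => rw [trans_succ W' hj, ih, trans_succ W hj, f.arm_app]

/-- The representation is supported on the long arm from `a` on, where it is generated by a
single vector at `a`. -/
def IsInterval (W : QRep F mountainD) (a : ℕ) : Prop :=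
  (∀ u : W.M vertexX, u = 0) ∧ (∀ u : W.M vertexY, u = 0) ∧
    (∀ k < a, ∀ u : W.M (vertexLong k), u = 0) ∧
    ∃ v : W.M (vertexLong a), v ≠ 0 ∧
      ∀ k (h : a ≤ k) (u : W.M (vertexLong k)), ∃ c : F, u = c • W.trans h v

theorem Indec.isInterval_of_functionals (hW : W.Indec) {n : ℕ} (v : W.M (vertexLong (n + 1)))
    (ψ : ∀ k, W.M (vertexLong k) →ₗ[F] F) (hv : ψ (n + 1) v = 1)
    (harm : ∀ u, ψ (n + 1) (W.arm n u) = 0)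
    (hψ : ∀ k (h : n + 1 ≤ k), (∀ u, ψ (k + 1) (W.arm k u) = ψ k u) ∨
      W.trans (Nat.le_succ_of_le h) v = 0) : W.IsInterval (n + 1) := by
  let g : ∀ k, W.M (vertexLong k) →ₗ[F] W.M (vertexLong k) := fun k =>
    if h : n + 1 ≤ k then (ψ k).smulRight (W.trans h v) else 0
  have hg : ∀ k (h : n + 1 ≤ k) u, g k u = ψ k u • W.trans h v := fun k h u => by
    simp only [g, dif_pos h]
    rfl
  have hg0 : ∀ k, k < n + 1 → ∀ u, g k u = 0 := fun k h u => by
    simp only [g, dif_neg (by omega : ¬ n + 1 ≤ k)]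
    rfl
  have hone : ∀ k (h : n + 1 ≤ k), ψ k (W.trans h v) = 1 ∨ W.trans h v = 0 := by
    intro k h
    induction k, h using Nat.le_induction with
    | base => exact .inl (by rw [trans_self, hv])
    | succ k h ih =>
      rcases hψ k h with hk | hk
      · rw [trans_succ W h, hk]
        exact ih.imp_right fun h => by rw [h, map_zero]
      · exact .inr hk
  let app : ∀ i : mountainD.V, W.M i →ₗ[F] W.M i
    | .x => 0
    | .y => 0
    | .long k => g k
  let e : Hom W W := mkHom app
    (fun u => (congrArg W.legX (hg0 0 n.succ_pos u)).trans (map_zero _))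
    (fun u => (congrArg W.legY (hg0 0 n.succ_pos u)).trans (map_zero _))
    (fun k u => by
      change W.arm k (g k u) = g (k + 1) (W.arm k u)
      rcases lt_trichotomy k n with hk | rfl | hk
      · rw [hg0 k (by omega), hg0 (k + 1) (by omega), map_zero]
      · rw [hg0 k (by omega), hg _ le_rfl, harm, map_zero, zero_smul]
      · have hk' : n + 1 ≤ k := hk
        rw [hg k hk', hg (k + 1) (by omega), map_smul, ← trans_succ]
        rcases hψ k hk' with h | h
        · rw [h]
        · rw [h, smul_zero, smul_zero])
  have hv0 : v ≠ 0 := by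
    rintro rfl
    simp at hv
  have hid := hW.eq_of_idempotent e (fun i u => by
    match i with
    | .x => rfl
    | .y => rfl
    | .long k =>
      change g k (g k u) = g k u
      by_cases h : n + 1 ≤ k
      · rw [hg k h, hg k h, map_smul, smul_eq_mul]
        rcases hone k h with h1 | h1
        · rw [h1, mul_one]
        · rw [h1, smul_zero, smul_zero]
      · rw [hg0 k (by omega), hg0 k (by omega)]) (i₀ := vertexLong (n + 1)) (v := v) (by
    change g (n + 1) v ≠ 0
    rwa [hg _ le_rfl, hv, one_smul, trans_self])
  refine ⟨fun u => (hid vertexX u).symm, fun u => (hid vertexY u).symm, fun k hk u => ?_, v, hv0,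
    fun k h u => ⟨ψ k u, ?_⟩⟩
  · rw [← hg0 k hk u]
    exact (hid (vertexLong k) u).symm
  · rw [← hg k h u]
    exact (hid (vertexLong k) u).symm

theorem Indec.isInterval (hW : W.Indec) {n : ℕ} (hn : ¬ Function.Surjective (W.arm n)) :
    W.IsInterval (n + 1) := by
  classical
  set J := LinearMap.range (W.arm n) with hJ
  have hne : J ≠ ⊤ := fun h => hn (LinearMap.range_eq_top.1 h)
  by_cases hex : ∃ j, ∃ h : n + 1 ≤ j, ¬ LinearMap.ker (W.trans h) ≤ J
  · obtain ⟨j, h, hker, hmin⟩ : ∃ j, ∃ h : n + 1 ≤ j, ¬ LinearMap.ker (W.trans h) ≤ J ∧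
        ∀ b (hb : n + 1 ≤ b), b < j → LinearMap.ker (W.trans hb) ≤ J := by
      obtain ⟨h, hker⟩ := Nat.find_spec hex
      refine ⟨Nat.find hex, h, hker, fun b hb hbj => ?_⟩
      have := Nat.find_min hex hbj
      push Not at this
      exact this hb
    obtain ⟨v, hv, hvJ⟩ := SetLike.not_le_iff_exists.1 hker
    rw [LinearMap.mem_ker] at hv
    have hjn : n + 1 ≠ j := by
      intro hjn
      have : ∀ i (h : n + 1 ≤ i), n + 1 = i → W.trans h v = 0 → v = 0 := by
        rintro i h rfl h0
        rwa [trans_self] at h0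
      exact hvJ (this j h hjn hv ▸ J.zero_mem)
    obtain ⟨b, rfl⟩ : ∃ b, j = b + 1 := ⟨j - 1, by omega⟩
    have hb : n + 1 ≤ b := by omega
    have hvb : W.trans hb v ∉ J.map (W.trans hb) := by
      rintro ⟨w, hw, hwv⟩
      have h0 : W.trans hb (v - w) = 0 := by rw [map_sub, hwv, sub_self]
      exact hvJ ((Submodule.sub_mem_iff_left _ hw).1
        (hmin b hb b.lt_succ_self (LinearMap.mem_ker.2 h0)))
    obtain ⟨θ, hθv, hθ⟩ := exists_functional hvb
    let ψ : ∀ k, W.M (vertexLong k) →ₗ[F] F := fun k =>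
      if h : k ≤ b then θ ∘ₗ W.trans h else 0
    have hψ : ∀ k (h : k ≤ b) u, ψ k u = θ (W.trans h u) := fun k h u => by
      simp only [ψ, dif_pos h]
      rfl
    refine hW.isInterval_of_functionals v ψ ((hψ _ hb v).trans hθv)
      (fun u => (hψ _ hb _).trans (hθ _ ⟨_, ⟨u, rfl⟩, rfl⟩)) fun k hk => ?_
    rcases lt_or_ge k b with hkb | hkb
    · exact .inl fun u => by rw [hψ _ hkb, hψ _ hkb.le, trans_arm]
    · refine .inr ?_
      rw [← trans_trans W h (Nat.succ_le_succ hkb), hv, map_zero]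
  · push Not at hex
    obtain ⟨v, -, hv⟩ := SetLike.not_le_iff_exists.1 (fun h => hne (top_le_iff.1 h))
    let c := Module.DirectLimit.of F ℕ (fun k => W.M (vertexLong k)) (fun i j h => W.trans h)
    have hc : ∀ k u, c (k + 1) (W.arm k u) = c k u := fun k u => by
      have := Module.DirectLimit.of_f (R := F) (G := fun k => W.M (vertexLong k))
        (f := fun i j h => W.trans h) (hij := Nat.le_succ k) (x := u)
      rwa [trans_succ W le_rfl, trans_self] at this
    have : DirectedSystem (fun k => W.M (vertexLong k)) fun i j h => W.trans h :=
      ⟨fun i u => trans_self W _ u, fun i j k h h' u => trans_trans W h h' u⟩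
    have hvc : c (n + 1) v ∉ J.map (c (n + 1)) := by
      rintro ⟨w, hw, hwv⟩
      have h0 : c (n + 1) (v - w) = 0 := by rw [map_sub, hwv, sub_self]
      obtain ⟨j, hj, h0⟩ := Module.DirectLimit.of.zero_exact h0
      exact hv ((Submodule.sub_mem_iff_left _ hw).1 (hex j hj (LinearMap.mem_ker.2 h0)))
    obtain ⟨θ, hθv, hθ⟩ := exists_functional hvc
    exact hW.isInterval_of_functionals v (fun k => θ ∘ₗ c k) hθv
      (fun u => hθ _ ⟨_, ⟨u, rfl⟩, rfl⟩)
      (fun k _ => .inl fun u => congrArg θ (hc k u))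

/-- The map induced by the path from the trivalent vertex. -/
def proj (W : QRep F mountainD) : ∀ i : mountainD.V, W.M (vertexLong 0) →ₗ[F] W.M i
  | .x => W.legX
  | .y => W.legY
  | .long k => W.trans (Nat.zero_le k)

theorem proj_long_zero (u : W.M (vertexLong 0)) : W.proj (vertexLong 0) u = u :=
  trans_self W _ u

theorem arm_proj (k : ℕ) (u : W.M (vertexLong 0)) :
    W.arm k (W.proj (vertexLong k) u) = W.proj (vertexLong (k + 1)) u :=
  (trans_succ W k.zero_le _ u).symm

theorem Hom.app_proj (f : Hom W W') (i : mountainD.V) (u : W.M (vertexLong 0)) :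
    f.app i (W.proj i u) = W'.proj i (f.app (vertexLong 0) u) :=
  match i with
  | .x => (f.legX_app u).symm
  | .y => (f.legY_app u).symm
  | .long k => (f.trans_app k.zero_le u).symm

/-- The kernels of the maps along the long arm. -/
def chain (W : QRep F mountainD) (k : ℕ) : Submodule F (W.M (vertexLong 0)) :=
  LinearMap.ker (W.proj (vertexLong k))

theorem chain_monotone (W : QRep F mountainD) : Monotone W.chain :=
  monotone_nat_of_le_succ fun k u hu => by
    rw [chain, LinearMap.mem_ker] at hu ⊢
    rw [← arm_proj, hu, map_zero]

theorem chain_zero (W : QRep F mountainD) : W.chain 0 = ⊥ :=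
  (Submodule.eq_bot_iff _).2 fun u hu => by rwa [chain, LinearMap.mem_ker, proj_long_zero] at hu

/-- The representation is generated by its space at the trivalent vertex. -/
def IsGenerated (W : QRep F mountainD) : Prop := ∀ i, Function.Surjective (W.proj i)

theorem Indec.isIndecSystem (hW : W.Indec) (hG : W.IsGenerated) :
    IsIndecSystem (LinearMap.ker W.legX) (LinearMap.ker W.legY) W.chain := by
  intro g hgg hX hY hK hg
  have hker : ∀ i u, W.proj i u = 0 → W.proj i (g u) = 0 := fun i u =>
    match i with
    | .x => hX u
    | .y => hY u
    | .long k => hK k u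
  choose s hs using fun i => (W.proj i).exists_rightInverse_of_surjective
    (LinearMap.range_eq_top.2 (hG i))
  let app : ∀ i : mountainD.V, W.M i →ₗ[F] W.M i := fun i => W.proj i ∘ₗ g ∘ₗ s i
  have happ : ∀ i u, app i (W.proj i u) = W.proj i (g u) := fun i u => by
    have h := hker i (s i (W.proj i u) - u) (by
      rw [map_sub, sub_eq_zero]
      exact LinearMap.congr_fun (hs i) _)
    rw [map_sub, map_sub, sub_eq_zero] at h
    exact h
  have happ0 : ∀ u, app (vertexLong 0) u = g u := fun u => by
    have := happ (vertexLong 0) u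
    rwa [proj_long_zero, proj_long_zero] at this
  let e : Hom W W := mkHom app
    (fun u => (congrArg W.legX (happ0 u)).trans (happ vertexX u).symm)
    (fun u => (congrArg W.legY (happ0 u)).trans (happ vertexY u).symm)
    (fun k u => by
      obtain ⟨u, rfl⟩ := hG (vertexLong k) u
      rw [happ, arm_proj, arm_proj, happ])
  obtain ⟨v, hv⟩ := exists_apply_ne_zero hg
  have hid := hW.eq_of_idempotent e (fun i u => by
    obtain ⟨u, rfl⟩ := hG i u
    change app i (app i _) = app i _
    rw [happ, happ, hgg]) (i₀ := vertexLong 0) (v := v) (by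
      change app _ v ≠ 0
      rwa [happ0])
  exact fun u => (happ0 u).symm.trans (hid (vertexLong 0) u)

theorem Indec.isLine_or_isPlane (hW : W.Indec) (hG : W.IsGenerated) :
    IsLine F (W.M (vertexLong 0)) ∨
      IsPlane (LinearMap.ker W.legX) (LinearMap.ker W.legY) W.chain := by
  refine (hW.isIndecSystem hG).isLine_or_isPlane W.chain_monotone W.chain_zero ?_
  obtain ⟨i, w, hw⟩ := hW.1
  obtain ⟨u, rfl⟩ := hG i w
  exact ⟨u, fun h => hw (by rw [h, map_zero])⟩

theorem isGenerated_of_surjective (hX : Function.Surjective W.legX)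
    (hY : Function.Surjective W.legY) (hA : ∀ k, Function.Surjective (W.arm k)) :
    W.IsGenerated
  | .x => hX
  | .y => hY
  | .long k => by
    change Function.Surjective (W.proj (vertexLong k))
    induction k with
    | zero => exact fun u => ⟨u, proj_long_zero u⟩
    | succ k ih =>
      intro u
      obtain ⟨w, rfl⟩ := hA k u
      obtain ⟨v, rfl⟩ := ih w
      exact ⟨v, (arm_proj k v).symm⟩

/-- Classification of the indecomposable representations of the mountain quiver. -/
theorem Indec.classification (hW : W.Indec) :
    W.IsSimpleAt vertexX ∨ W.IsSimpleAt vertexY ∨ (∃ n, W.IsInterval (n + 1)) ∨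
      W.IsGenerated := by
  by_cases hX : Function.Surjective W.legX
  · by_cases hY : Function.Surjective W.legY
    · by_cases hA : ∀ k, Function.Surjective (W.arm k)
      · exact .inr (.inr (.inr (isGenerated_of_surjective hX hY hA)))
      · push Not at hA
        obtain ⟨n, hn⟩ := hA
        exact .inr (.inr (.inl ⟨n, hW.isInterval hn⟩))
    · obtain ⟨v, hv⟩ := not_forall.1 hY
      exact .inr (.inl (hW.isSimpleAt vertexY
        (fun | .ex => DV.noConfusion | .ey => DV.noConfusion | .el _ => DV.noConfusion)
        (LinearMap.range W.legY) (fun | .ey, _, u => ⟨u, rfl⟩) hv))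
  · obtain ⟨v, hv⟩ := not_forall.1 hX
    exact .inl (hW.isSimpleAt vertexX
      (fun | .ex => DV.noConfusion | .ey => DV.noConfusion | .el _ => DV.noConfusion)
      (LinearMap.range W.legX) (fun | .ex, _, u => ⟨u, rfl⟩) hv)

/-- The least element of an upward closed set of natural numbers, or `⊤`. -/
noncomputable def leastIndex (P : ℕ → Prop) : ℕ∞ := sInf ((↑) '' {k | P k})

theorem leastIndex_anti {P Q : ℕ → Prop} (h : ∀ k, P k → Q k) : leastIndex Q ≤ leastIndex P :=
  sInf_le_sInf (Set.image_mono h)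

theorem of_leastIndex_eq {P Q : ℕ → Prop} (hP : ∀ j k, j ≤ k → P j → P k)
    (h : leastIndex Q = leastIndex P) {k : ℕ} (hk : Q k) : P k := by
  have hle : leastIndex P ≤ k := h ▸ sInf_le ⟨k, hk, rfl⟩
  rcases ((↑) '' {k | P k} : Set ℕ∞).eq_empty_or_nonempty with hS | hS
  · rw [leastIndex, hS, sInf_empty] at hle
    exact absurd (top_le_iff.1 hle) (ENat.natCast_ne_top k)
  · obtain ⟨j, hj, hjk⟩ := csInf_mem hS
    exact hP j k (by rw [← Nat.cast_le (α := ℕ∞), hjk]; exact hle) hj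

/-- The rank of an indecomposable representation: it decreases along nonzero morphisms which are
not isomorphisms. -/
inductive HasRank (W : QRep F mountainD) : ℕ ×ₗ ℕ∞ ×ₗ ℕ∞ → Prop
  | simple (i : mountainD.V) (hi : ∀ k, i ≠ vertexLong k) (h : W.IsSimpleAt i) :
      HasRank W (toLex (4, toLex (0, 0)))
  | interval (n : ℕ) (h : W.IsInterval (n + 1)) :
      HasRank W (toLex (3, toLex (n,
        leastIndex fun k => n + 1 ≤ k ∧ ∀ u : W.M (vertexLong k), u = 0)))
  | generated (hG : W.IsGenerated) (h : IsLine F (W.M (vertexLong 0)) ∨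
      IsPlane (LinearMap.ker W.legX) (LinearMap.ker W.legY) W.chain) :
      HasRank W (toLex (stage (LinearMap.ker W.legX) (LinearMap.ker W.legY),
        toLex (leastIndex fun k => W.chain k ≠ ⊥, leastIndex fun k => W.chain k = ⊤)))

theorem Indec.exists_hasRank (hW : W.Indec) : ∃ r, W.HasRank r := by
  rcases hW.classification with h | h | ⟨n, h⟩ | h
  · exact ⟨_, .simple _ (fun k => DV.noConfusion) h⟩
  · exact ⟨_, .simple _ (fun k => DV.noConfusion) h⟩
  · exact ⟨_, .interval n h⟩
  · exact ⟨_, .generated h (hW.isLine_or_isPlane h)⟩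

theorem Hom.Nonzero.exists_apply_ne_zero {f : Hom W W'} (hf : f.Nonzero) :
    ∃ i u, u ≠ 0 ∧ f.app i u ≠ 0 := by
  obtain ⟨i, hi⟩ := hf
  obtain ⟨u, hu⟩ := _root_.exists_apply_ne_zero hi
  exact ⟨i, u, fun h => hu (by rw [h, map_zero]), hu⟩

theorem bijective_of_forall_eq_zero {E E' : Type} [AddCommGroup E] [Module F E] [AddCommGroup E']
    [Module F E'] (φ : E →ₗ[F] E') (h : ∀ u : E, u = 0) (h' : ∀ u : E', u = 0) :
    Function.Bijective φ :=
  ⟨fun u w _ => (h u).trans (h w).symm, fun u => ⟨0, by rw [map_zero, h' u]⟩⟩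

theorem IsInterval.app_ne_zero {f : Hom W W'} (hf : f.Nonzero) {a : ℕ} (h : W.IsInterval a) :
    ∃ v : W.M (vertexLong a), f.app (vertexLong a) v ≠ 0 ∧
      ∀ k (h : a ≤ k) (u : W.M (vertexLong k)), ∃ c : F, u = c • W.trans h v := by
  obtain ⟨hX, hY, hlow, v, -, hv⟩ := h
  refine ⟨v, fun h0 => ?_, hv⟩
  obtain ⟨i, u, hu, hfu⟩ := hf.exists_apply_ne_zero
  match i with
  | .x => exact hu (hX u)
  | .y => exact hu (hY u)
  | .long k =>
    rcases lt_or_ge k a with hk | hk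
    · exact hu (hlow k hk u)
    · obtain ⟨c, rfl⟩ := hv k hk u
      refine hfu ?_
      change f.app (vertexLong k) (c • W.trans hk v) = 0
      rw [map_smul, ← f.trans_app, h0, map_zero, smul_zero]

theorem IsInterval.rank_lt_or_isIso {f : Hom W W'} (hf : f.Nonzero) {n m : ℕ}
    (h : W.IsInterval (n + 1)) (h' : W'.IsInterval (m + 1)) :
    m < n ∨ m = n ∧
      leastIndex (fun k => m + 1 ≤ k ∧ ∀ u : W'.M (vertexLong k), u = 0) <
        leastIndex (fun k => n + 1 ≤ k ∧ ∀ u : W.M (vertexLong k), u = 0) ∨ f.IsIso := by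
  obtain ⟨v, hfv, hv⟩ := h.app_ne_zero hf
  obtain ⟨hX, hY, hlow, -⟩ := h
  obtain ⟨hX', hY', hlow', v', -, hv'⟩ := h'
  have hmn : m ≤ n := not_lt.1 fun hlt => hfv (hlow' _ (by omega) _)
  rcases hmn.lt_or_eq with hmn | rfl
  · exact .inl hmn
  obtain ⟨c, hc⟩ := hv' _ le_rfl (f.app _ v)
  rw [trans_self] at hc
  have hc0 : c ≠ 0 := by
    rintro rfl
    rw [zero_smul] at hc
    exact hfv hc
  have hft : ∀ k (hk : m + 1 ≤ k), f.app _ (W.trans hk v) = c • W'.trans hk v' := fun k hk => by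
    rw [← f.trans_app, hc, map_smul]
  have hle : leastIndex (fun k => m + 1 ≤ k ∧ ∀ u : W'.M (vertexLong k), u = 0) ≤
      leastIndex (fun k => m + 1 ≤ k ∧ ∀ u : W.M (vertexLong k), u = 0) :=
    leastIndex_anti fun k ⟨hk, hzero⟩ => ⟨hk, fun u => by
      have h0 := hft k hk
      rw [hzero (W.trans hk v), map_zero, eq_comm, smul_eq_zero, or_iff_right hc0] at h0
      obtain ⟨d, rfl⟩ := hv' k hk u
      rw [h0, smul_zero]⟩
  rcases hle.lt_or_eq with hlt | heq
  · exact .inr (.inl ⟨rfl, hlt⟩)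
  refine .inr (.inr fun i => ?_)
  match i with
  | .x => exact bijective_of_forall_eq_zero (f.app vertexX) hX hX'
  | .y => exact bijective_of_forall_eq_zero (f.app vertexY) hY hY'
  | .long k =>
    rcases lt_or_ge k (m + 1) with hk | hk
    · exact bijective_of_forall_eq_zero (f.app (vertexLong k)) (hlow k hk) (hlow' k hk)
    by_cases h0 : W'.trans hk v' = 0
    · have hzero' : ∀ u : W'.M (vertexLong k), u = 0 := fun u => by
        obtain ⟨d, rfl⟩ := hv' k hk u
        rw [h0, smul_zero]
      refine bijective_of_forall_eq_zero (f.app (vertexLong k))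
        (of_leastIndex_eq (fun i j hij hi => ?_) heq ⟨hk, hzero'⟩).2 hzero'
      refine ⟨hi.1.trans hij, fun u => ?_⟩
      obtain ⟨d, rfl⟩ := hv j (hi.1.trans hij) u
      rw [← trans_trans W hi.1 hij, hi.2 (W.trans hi.1 v), map_zero, smul_zero]
    · refine ⟨(injective_iff_map_eq_zero (f.app (vertexLong k))).2 fun u hu => ?_, fun u => ?_⟩
      · obtain ⟨d, rfl⟩ := hv k hk u
        rw [map_smul, hft, smul_smul] at hu
        rw [(mul_eq_zero.1 ((smul_eq_zero.1 hu).resolve_right h0)).resolve_right hc0, zero_smul]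
      · obtain ⟨d, rfl⟩ := hv' k hk u
        refine ⟨(d / c) • W.trans hk v, (map_smul (f.app (vertexLong k)) _ _).trans ?_⟩
        rw [hft, smul_smul, div_mul_cancel₀ _ hc0]

theorem IsGenerated.app_ne_zero {f : Hom W W'} (hf : f.Nonzero) (h : W.IsGenerated) :
    f.app (vertexLong 0) ≠ 0 := by
  intro h0
  obtain ⟨i, u, -, hu⟩ := hf.exists_apply_ne_zero
  obtain ⟨u, rfl⟩ := h i u
  rw [f.app_proj, h0, LinearMap.zero_apply, map_zero] at hu
  exact hu rfl

theorem IsGenerated.isIso {f : Hom W W'} (hG : W.IsGenerated) (hG' : W'.IsGenerated)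
    (h : IsSystemIso (f.app (vertexLong 0)) (LinearMap.ker W.legX) (LinearMap.ker W.legY) W.chain
      (LinearMap.ker W'.legX) (LinearMap.ker W'.legY) W'.chain) : f.IsIso := by
  obtain ⟨hbij, hX, hY, hK⟩ := h
  have hker : ∀ i u, W'.proj i (f.app (vertexLong 0) u) = 0 → W.proj i u = 0 := fun i u =>
    match i with
    | .x => hX u
    | .y => hY u
    | .long k => hK k u
  refine fun i => ⟨(injective_iff_map_eq_zero (f.app i)).2 fun u hu => ?_, fun u => ?_⟩
  · obtain ⟨u, rfl⟩ := hG i u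
    rw [f.app_proj] at hu
    exact hker i u hu
  · obtain ⟨u, rfl⟩ := hG' i u
    obtain ⟨w, rfl⟩ := hbij.2 u
    exact ⟨W.proj i w, f.app_proj i w⟩

theorem stage_le_two {E : Type} [AddCommGroup E] [Module F E] (X Y : Submodule F E) :
    stage X Y ≤ 2 := by
  unfold stage
  split_ifs <;> omega

theorem HasRank.lt_or_isIso {r r' : ℕ ×ₗ ℕ∞ ×ₗ ℕ∞} (h : W.HasRank r) (h' : W'.HasRank r')
    {f : Hom W W'} (hf : f.Nonzero) : r' < r ∨ f.IsIso := by
  obtain ⟨i, u, hu, hfu⟩ := hf.exists_apply_ne_zero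
  cases h with
  | simple j hj h =>
    obtain rfl : i = j := by_contra fun hij => hu (h.2 i hij u)
    cases h' with
    | simple j' hj' h' =>
      obtain rfl : i = j' := by_contra fun hij => hfu (h'.2 i hij _)
      refine .inr fun j => ?_
      by_cases hji : j = i
      · subst hji
        have hne : f.app j ≠ 0 := fun h0 => hfu (by rw [h0, LinearMap.zero_apply])
        exact ⟨IsLine.injective h.1 hne, IsLine.surjective h'.1 hne⟩
      · exact bijective_of_forall_eq_zero _ (h.2 j hji) (h'.2 j hji)
    | interval n h' => exact .inl (Prod.Lex.toLex_lt_toLex.2 (.inl (by omega)))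
    | generated =>
      exact .inl (Prod.Lex.toLex_lt_toLex.2 (.inl ((stage_le_two _ _).trans_lt (by omega))))
  | interval n h =>
    cases h' with
    | simple j hj h' =>
      obtain ⟨v, hv, -⟩ := h.app_ne_zero hf
      exact absurd (h'.2 _ (hj _).symm _) hv
    | interval m h' =>
      rcases h.rank_lt_or_isIso hf h' with hmn | ⟨rfl, hlt⟩ | hiso
      · exact .inl (Prod.Lex.toLex_lt_toLex.2 (.inr ⟨rfl, Prod.Lex.toLex_lt_toLex.2
          (.inl (Nat.cast_lt.2 hmn))⟩))
      · exact .inl (Prod.Lex.toLex_lt_toLex.2 (.inr ⟨rfl, Prod.Lex.toLex_lt_toLex.2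
          (.inr ⟨rfl, hlt⟩)⟩))
      · exact .inr hiso
    | generated =>
      exact .inl (Prod.Lex.toLex_lt_toLex.2 (.inl ((stage_le_two _ _).trans_lt (by omega))))
  | generated hG h =>
    have hφ := hG.app_ne_zero hf
    obtain ⟨w, hw⟩ := _root_.exists_apply_ne_zero hφ
    cases h' with
    | simple j hj h' => exact absurd (h'.2 _ (hj _).symm _) hw
    | interval n h' => exact absurd (h'.2.2.1 0 n.succ_pos _) hw
    | generated hG' h' =>
      have hker : ∀ i, ∀ u ∈ LinearMap.ker (W.proj i),
          f.app (vertexLong 0) u ∈ LinearMap.ker (W'.proj i) := fun i u hu => by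
        rw [LinearMap.mem_ker] at hu ⊢
        rw [← f.app_proj, hu, map_zero]
      have hX := hker vertexX
      have hY := hker vertexY
      have hK := fun k => hker (vertexLong k)
      rcases (stage_le_stage h hφ hX hY).lt_or_eq with hs | hs
      · exact .inl (Prod.Lex.toLex_lt_toLex.2 (.inl hs))
      have hk := ne_bot_and_eq_top_of_stage_eq h h' hφ hs hX hY hK
      rcases (leastIndex_anti fun k => (hk k).1).lt_or_eq with hb | hb
      · exact .inl (Prod.Lex.toLex_lt_toLex.2 (.inr ⟨hs, Prod.Lex.toLex_lt_toLex.2 (.inl hb)⟩))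
      rcases (leastIndex_anti fun k => (hk k).2).lt_or_eq with ht | ht
      · exact .inl (Prod.Lex.toLex_lt_toLex.2 (.inr ⟨hs, Prod.Lex.toLex_lt_toLex.2
          (.inr ⟨hb, ht⟩)⟩))
      have hbot : ∀ i j, i ≤ j → W.chain i ≠ ⊥ → W.chain j ≠ ⊥ := fun i j hij hi =>
        ne_bot_of_le_ne_bot hi (W.chain_monotone hij)
      have htop : ∀ i j, i ≤ j → W.chain i = ⊤ → W.chain j = ⊤ := fun i j hij hi =>
        top_le_iff.1 (hi ▸ W.chain_monotone hij)
      exact .inr (hG.isIso hG' (isSystemIso_of_stage_eq h h' hφ hs hX hY hK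
        (fun k => not_iff_not.1 ⟨(hk k).1, of_leastIndex_eq hbot hb⟩)
        (fun k => ⟨(hk k).2, of_leastIndex_eq htop ht⟩)))

end Mountain

end QRep

/-- There is no infinite sequence of indecomposable FLEI representations
of the mountain `D∞` quiver connected by morphisms each of which is nonzero and not an
isomorphism. -/
theorem stmt7 (F : Type) [Field F] :
    ¬ ∃ (W : ℕ → QRep F mountainD) (f : ∀ n : ℕ, QRep.Hom (W n) (W (n + 1))),
      (∀ n, (W n).Indec ∧ (W n).IsFLEI) ∧
      (∀ n, (f n).Nonzero ∧ ¬ (f n).IsIso) := by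
  rintro ⟨W, f, hW, hf⟩
  choose r hr using fun n => (hW n).1.exists_hasRank
  exact not_strictAnti_of_wellFoundedLT r (strictAnti_nat_of_succ_lt fun n =>
    ((hr n).lt_or_isIso (hr (n + 1)) (hf n).1).resolve_right (hf n).2)
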